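/- Let G ∈ 𝒞𝒢^s(n) with 2 ≤ s ≤ n−3, let v* be a vertex of minimum degree t of G, set X = N(v*), Y = V(G) ∖ N[v*], and suppose G is X-incomplete, i.e., G[Y] ≅ K_{n−t−1} with n−t−1 ≥ 2 and G[X] is not complete. Then G ∈ 𝒢_1^s(n) if there exist two non-adjacent vertices x_1, x_2 ∈ X with N_Y(x_1) = N_Y(x_2), and G ∈ 𝒢_3^s(n) otherwise. -/

import Mathlib

open Matrix BigOperators

namespace TwoPosEig

variable {V : Type*}

/-- The real adjacency matrix of a simple graph (classical decidability). -/
noncomputable def adjMat [Fintype V] [DecidableEq V] (G : SimpleGraph V) : Matrix V V ℝ :=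
  letI := Classical.decRel G.Adj
  G.adjMatrix ℝ

lemma adjMat_isHermitian [Fintype V] [DecidableEq V] (G : SimpleGraph V) :
    (adjMat G).IsHermitian := by
  letI := Classical.decRel G.Adj
  rw [Matrix.IsHermitian, Matrix.conjTranspose_eq_transpose_of_trivial]
  exact SimpleGraph.isSymm_adjMatrix G

/-- The eigenvalues of (the adjacency matrix of) a graph, as a function on vertices. -/
noncomputable def eigs [Fintype V] [DecidableEq V] (G : SimpleGraph V) : V → ℝ :=
  (adjMat_isHermitian G).eigenvalues

/-- `p(G)`: the number of positive eigenvalues (with multiplicity). -/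
noncomputable def posCount [Finite V] (G : SimpleGraph V) : ℕ :=
  letI := Fintype.ofFinite V
  letI := Classical.decEq V
  Nat.card {i : V // 0 < eigs G i}

/-- `η(G)`: the number of zero eigenvalues (with multiplicity), the nullity. -/
noncomputable def nullCount [Finite V] (G : SimpleGraph V) : ℕ :=
  letI := Fintype.ofFinite V
  letI := Classical.decEq V
  Nat.card {i : V // eigs G i = 0}

/-- `λ_k(G)`: the `k`-th largest eigenvalue (1-indexed); junk value `0` out of range. -/
noncomputable def lam [Finite V] (G : SimpleGraph V) (k : ℕ) : ℝ :=
  letI := Fintype.ofFinite V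
  letI := Classical.decEq V
  (((Finset.univ.val.map (eigs G)).sort (· ≤ ·)).reverse).getD (k - 1) 0

/-- Membership in `𝒢^s(n)` (the order `n` being the cardinality of the vertex type):
`p(G) = 2` and `η(G) = s`. -/
def memClass [Finite V] (s : ℕ) (G : SimpleGraph V) : Prop :=
  posCount G = 2 ∧ nullCount G = s

/-- `v` is a congruent vertex of I-type: some other vertex `u`, non-adjacent to `v`,
has the same neighbourhood. -/
def ITypeVertex (G : SimpleGraph V) (v : V) : Prop :=
  ∃ u, u ≠ v ∧ ¬ G.Adj u v ∧ G.neighborSet u = G.neighborSet v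

/-- `u` is a congruent vertex of II-type: there are two non-adjacent vertices `v, w`
such that `N(u)` is a disjoint union of `N(v)` and `N(w)`. -/
def IITypeVertex (G : SimpleGraph V) (u : V) : Prop :=
  ∃ v w, v ≠ w ∧ ¬ G.Adj v w ∧ Disjoint (G.neighborSet v) (G.neighborSet w) ∧
    G.neighborSet u = G.neighborSet v ∪ G.neighborSet w

/-- `u v x y` is a congruent (induced) quadrangle with congruent edges `uv`, `xy`. -/
def CongruentQuad (G : SimpleGraph V) (u v x y : V) : Prop :=
  u ≠ v ∧ u ≠ x ∧ u ≠ y ∧ v ≠ x ∧ v ≠ y ∧ x ≠ y ∧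
  G.Adj u v ∧ G.Adj v x ∧ G.Adj x y ∧ G.Adj y u ∧ ¬ G.Adj u x ∧ ¬ G.Adj v y ∧
  G.neighborSet u \ {y, v} = G.neighborSet v \ {u, x} ∧
  G.neighborSet x \ {v, y} = G.neighborSet y \ {x, u}

/-- A congruent vertex of III-type: a vertex of some congruent quadrangle. -/
def IIITypeVertex (G : SimpleGraph V) (z : V) : Prop :=
  ∃ u v x y, CongruentQuad G u v x y ∧ (z = u ∨ z = v ∨ z = x ∨ z = y)

/-- Membership in `𝒢_1^s(n)`: a connected graph obtained by adding a congruent vertex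
of I-type to some graph in `𝒢^{s-1}(n-1)`. -/
def memG1 {n : ℕ} (s : ℕ) (G : SimpleGraph (Fin n)) : Prop :=
  G.Connected ∧ ∃ v : Fin n, ITypeVertex G v ∧ memClass (s - 1) (G.induce {v}ᶜ)

/-- Membership in `𝒢_2^s(n)`. -/
def memG2 {n : ℕ} (s : ℕ) (G : SimpleGraph (Fin n)) : Prop :=
  G.Connected ∧ ∃ v : Fin n, IITypeVertex G v ∧ memClass (s - 1) (G.induce {v}ᶜ)

/-- Membership in `𝒢_3^s(n)`. -/
def memG3 {n : ℕ} (s : ℕ) (G : SimpleGraph (Fin n)) : Prop :=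
  G.Connected ∧ ∃ v : Fin n, IIITypeVertex G v ∧ memClass (s - 1) (G.induce {v}ᶜ)

/-- Oboudi's graph `G_m`: two cliques `K_{⌈m/2⌉}` (on `v_1, …`) and `K_{⌊m/2⌋}`
(on `w_1, …`), where `v_i ∼ w_j` iff `j ≥ ⌊m/2⌋ - i + 2` (1-indexed), i.e. (0-indexed)
`⌊m/2⌋ ≤ i + j`. -/
def oboudi (m : ℕ) : SimpleGraph (Fin ((m + 1) / 2) ⊕ Fin (m / 2)) :=
  SimpleGraph.fromRel fun a b =>
    match a, b with
    | Sum.inl _, Sum.inl _ => True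
    | Sum.inr _, Sum.inr _ => True
    | Sum.inl i, Sum.inr j => m / 2 ≤ (i : ℕ) + (j : ℕ)
    | Sum.inr _, Sum.inl _ => False

/-- The generalized lexicographic product `G[K_{t v}]`: each vertex `v` is replaced by a
clique of order `t v`, with complete joins along edges of `G`. -/
def lexProd (G : SimpleGraph V) (t : V → ℕ) : SimpleGraph (Σ v : V, Fin (t v)) :=
  SimpleGraph.fromRel fun a b => a.1 = b.1 ∨ G.Adj a.1 b.1

/-- Index conversion identifying the vertices `v_1, …, v_{⌈k/2⌉}, w_1, …, w_{⌊k/2⌋}`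
of `G_k` with `Fin k` (in this order). -/
def toIdx {k : ℕ} : Fin ((k + 1) / 2) ⊕ Fin (k / 2) → Fin k
  | Sum.inl i => ⟨(i : ℕ), by have := i.isLt; omega⟩
  | Sum.inr j => ⟨(k + 1) / 2 + (j : ℕ), by have := j.isLt; omega⟩

/-- `B_k(n_1, …, n_k) = G_k[K_{n_1}, …, K_{n_k}]`. -/
def bGraph (k : ℕ) (nn : Fin k → ℕ) :
    SimpleGraph (Σ v : Fin ((k + 1) / 2) ⊕ Fin (k / 2), Fin (nn (toIdx v))) :=
  lexProd (oboudi k) fun v => nn (toIdx v)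

/-- Membership in `𝓓* = {B_k(n_1,…,n_k) ∈ 𝓑_k^{00}(n) : 4 ≤ k ≤ 14, n ≤ 14}` (up to
isomorphism). -/
def memDstar {n : ℕ} (G : SimpleGraph (Fin n)) : Prop :=
  ∃ (k : ℕ) (nn : Fin k → ℕ), 4 ≤ k ∧ k ≤ 14 ∧ (∀ i, 1 ≤ nn i) ∧ (∑ i, nn i) ≤ 14 ∧
    lam (bGraph k nn) 3 = 0 ∧ lam (bGraph k nn) 4 = 0 ∧ Nonempty (G ≃g bGraph k nn)

/-- The degree of a vertex. -/
noncomputable def deg [Finite V] (G : SimpleGraph V) (v : V) : ℕ :=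
  Nat.card (G.neighborSet v)

/-- `v` is a vertex of minimum degree. -/
def IsMinDegVertex [Finite V] (G : SimpleGraph V) (v : V) : Prop :=
  ∀ w, deg G v ≤ deg G w

/-- The set `Y = V(G) ∖ N[v]`. -/
def Yset (G : SimpleGraph V) (v : V) : Set V :=
  (G.neighborSet v ∪ {v})ᶜ

/-- `G` is `X`-complete with respect to `v`: `G[Y] ≅ K_{n-t-1}` with `n-t-1 ≥ 2`
and `G[X]` is complete, where `X = N(v)`, `Y = V(G) ∖ N[v]`. -/
def IsXComplete [Finite V] (G : SimpleGraph V) (v : V) : Prop :=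
  2 ≤ (Yset G v).ncard ∧ (Yset G v).Pairwise G.Adj ∧ (G.neighborSet v).Pairwise G.Adj

/-- An `X`-complete graph is reduced when the traces on `Y` of the neighbourhoods of
vertices of `X` form a chain. -/
def IsReduced (G : SimpleGraph V) (v : V) : Prop :=
  ∀ x ∈ G.neighborSet v, ∀ x' ∈ G.neighborSet v,
    G.neighborSet x ∩ Yset G v ⊆ G.neighborSet x' ∩ Yset G v ∨
    G.neighborSet x' ∩ Yset G v ⊆ G.neighborSet x ∩ Yset G v

/-! ### Spectral tools -/

lemma quad_diag {V : Type*} [Fintype V] [DecidableEq V] (U : Matrix V V ℝ) (d w : V → ℝ) :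
    w ⬝ᵥ ((U * diagonal d * Uᵀ) *ᵥ w) = ∑ i, d i * (Uᵀ *ᵥ w) i ^ 2 := by
  rw [← mulVec_mulVec, ← mulVec_mulVec, dotProduct_mulVec, ← mulVec_transpose]
  simp only [dotProduct, mulVec_diagonal]
  refine Finset.sum_congr rfl fun i _ => ?_
  ring

lemma exists_diag {V : Type*} [Fintype V] [DecidableEq V] {M : Matrix V V ℝ}
    (hM : M.IsHermitian) :
    ∃ U : Matrix V V ℝ, Uᵀ * U = 1 ∧ M = U * diagonal hM.eigenvalues * Uᵀ := by
  refine ⟨hM.eigenvectorUnitary, ?_, ?_⟩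
  · have := Unitary.coe_star_mul_self hM.eigenvectorUnitary
    rwa [star_eq_conjTranspose, conjTranspose_eq_transpose_of_trivial] at this
  · have := hM.spectral_theorem
    rw [Unitary.conjStarAlgAut_apply, star_eq_conjTranspose,
      conjTranspose_eq_transpose_of_trivial] at this
    exact this

/-- A subspace on which `σ M` is positive definite has dimension at most the number
of eigenvalues of `M` of sign `σ`. -/
lemma card_le_of_posDef {V ι : Type*} [Fintype V] [DecidableEq V] [Fintype ι]
    {M : Matrix V V ℝ} (hM : M.IsHermitian) (σ : ℝ)
    (L : (ι → ℝ) →ₗ[ℝ] (V → ℝ)) (hL : ∀ c, c ≠ 0 → 0 < σ * (L c ⬝ᵥ (M *ᵥ L c))) :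
    Nat.card ι ≤ Nat.card {i : V // 0 < σ * hM.eigenvalues i} := by
  classical
  obtain ⟨U, -, hU⟩ := exists_diag hM
  by_contra! hlt
  let T : (ι → ℝ) →ₗ[ℝ] ({i : V // 0 < σ * hM.eigenvalues i} → ℝ) :=
    (LinearMap.funLeft ℝ ℝ Subtype.val) ∘ₗ (Matrix.mulVecLin Uᵀ) ∘ₗ L
  have hker : LinearMap.ker T ≠ ⊥ := by
    apply LinearMap.ker_ne_bot_of_finrank_lt
    simpa [Nat.card_eq_fintype_card] using hlt
  obtain ⟨c, hc, hc0⟩ := (Submodule.ne_bot_iff _).1 hker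
  have h1 := hL c hc0
  generalize hd : hM.eigenvalues = d at *
  rw [hU, quad_diag, Finset.mul_sum] at h1
  refine absurd h1 (not_lt.2 (Finset.sum_nonpos fun i _ => ?_))
  by_cases hi : 0 < σ * d i
  · have : (Uᵀ *ᵥ L c) i = 0 := by
      have := congrFun (LinearMap.mem_ker.1 hc) ⟨i, hi⟩
      exact this
    rw [this]; simp
  · have := sq_nonneg ((Uᵀ *ᵥ L c) i)
    nlinarith

lemma exists_posDef {V : Type*} [Fintype V] [DecidableEq V]
    {M : Matrix V V ℝ} (hM : M.IsHermitian) (σ : ℝ) :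
    ∃ L : ({i : V // 0 < σ * hM.eigenvalues i} → ℝ) →ₗ[ℝ] (V → ℝ),
      ∀ c, c ≠ 0 → 0 < σ * (L c ⬝ᵥ (M *ᵥ L c)) := by
  classical
  obtain ⟨U, hUU, hU⟩ := exists_diag hM
  generalize hd : hM.eigenvalues = d at *
  let E : Matrix V {i : V // 0 < σ * d i} ℝ := fun a i => if a = i.1 then 1 else 0
  have hE : ∀ c (a : {i : V // 0 < σ * d i}), (E *ᵥ c) a.1 = c a := by
    intro c a
    simp [E, mulVec, dotProduct, Subtype.coe_inj]
  have hE' : ∀ c (a : V), ¬ 0 < σ * d a → (E *ᵥ c) a = 0 := by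
    intro c a ha
    simp only [E, mulVec, dotProduct]
    refine Finset.sum_eq_zero fun i _ => ?_
    rw [if_neg, zero_mul]
    rintro rfl
    exact ha i.2
  refine ⟨Matrix.mulVecLin (U * E), fun c hc => ?_⟩
  rw [hU, quad_diag, Finset.mul_sum]
  have hx : Uᵀ *ᵥ (U * E).mulVecLin c = E *ᵥ c := by
    rw [mulVecLin_apply, mulVec_mulVec, ← Matrix.mul_assoc, hUU, Matrix.one_mul]
  rw [hx]
  obtain ⟨a, ha⟩ := Function.ne_iff.1 hc
  refine Finset.sum_pos' (fun i _ => ?_) ⟨a.1, Finset.mem_univ _, ?_⟩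
  · by_cases hi : 0 < σ * d i
    · have := sq_nonneg ((E *ᵥ c) i)
      rw [← mul_assoc]; positivity
    · rw [hE' c i hi]; simp
  · rw [hE, ← mul_assoc]
    have := a.2
    have h2 : 0 < c a ^ 2 := by
      have : c a ≠ 0 := ha
      positivity
    positivity

lemma adjMat_apply {V : Type*} [Fintype V] [DecidableEq V] (G : SimpleGraph V) (i j : V)
    [Decidable (G.Adj i j)] : adjMat G i j = if G.Adj i j then 1 else 0 := by
  simp only [adjMat, SimpleGraph.adjMatrix_apply]
  congr

lemma card_sign_le {V W : Type*} [Fintype V] [DecidableEq V] [Fintype W] [DecidableEq W]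
    {M : Matrix V V ℝ} (hM : M.IsHermitian) {N : Matrix W W ℝ} (hN : N.IsHermitian) (σ : ℝ)
    (f : (V → ℝ) →ₗ[ℝ] (W → ℝ)) (hf : ∀ x, f x ⬝ᵥ (N *ᵥ f x) = x ⬝ᵥ (M *ᵥ x)) :
    Nat.card {i : V // 0 < σ * hM.eigenvalues i} ≤
      Nat.card {i : W // 0 < σ * hN.eigenvalues i} := by
  obtain ⟨L, hL⟩ := exists_posDef hM σ
  refine card_le_of_posDef hN σ (f ∘ₗ L) fun c hc => ?_
  simpa [hf] using hL c hc

lemma card_split {V : Type*} [Fintype V] (d : V → ℝ) :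
    Nat.card {i : V // 0 < 1 * d i} + Nat.card {i : V // 0 < (-1) * d i} +
      Nat.card {i : V // d i = 0} = Nat.card V := by
  classical
  simp only [Nat.card_eq_fintype_card, Fintype.card_subtype]
  rw [← Finset.card_univ, ← Finset.card_union_of_disjoint, ← Finset.card_union_of_disjoint]
  · congr 1
    ext i
    simp only [Finset.mem_union, Finset.mem_filter, Finset.mem_univ, true_and, iff_true]
    rcases lt_trichotomy (d i) 0 with h | h | h
    · left; right; linarith
    · right; exact h
    · left; left; linarith
  · rw [Finset.disjoint_left]
    intro i
    simp only [Finset.mem_union, Finset.mem_filter, Finset.mem_univ, true_and]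
    rintro (h | h) hzero <;> rw [hzero] at h <;> simp at h
  · rw [Finset.disjoint_left]
    intro i
    simp only [Finset.mem_filter, Finset.mem_univ, true_and]
    intro h hzero
    linarith

/-- Deleting a vertex in the support of a null vector keeps the number of positive
eigenvalues and decreases the nullity by one. -/
lemma sign_delete {V : Type*} [Fintype V] [DecidableEq V] (G : SimpleGraph V) (z : V)
    [Fintype ({z}ᶜ : Set V)] [DecidableEq ({z}ᶜ : Set V)]
    (w : V → ℝ) (hw : adjMat G *ᵥ w = 0) (hz : w z ≠ 0) (σ : ℝ) :
    Nat.card {i // 0 < σ * eigs (G.induce ({z}ᶜ : Set V)) i} =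
      Nat.card {i // 0 < σ * eigs G i} := by
  classical
  let S : Set V := {z}ᶜ
  have hsub : ∀ (x : V → ℝ) (y : S → ℝ), x z = 0 → (∀ i : S, x i = y i) →
      y ⬝ᵥ (adjMat (G.induce S) *ᵥ y) = x ⬝ᵥ (adjMat G *ᵥ x) := by
    intro x y hx hxy
    have key : ∀ g : V → ℝ, g z = 0 → ∑ i, g i = ∑ i : S, g i := by
      intro g hg
      rw [← Finset.sum_erase Finset.univ hg]
      refine Finset.sum_subtype (p := fun i => i ∈ S) _ (fun i => ?_) g
      simp [S]
    simp only [dotProduct, mulVec]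
    rw [key _ (by rw [hx, zero_mul])]
    refine Finset.sum_congr rfl fun i _ => ?_
    rw [key _ (by rw [hx, mul_zero]), hxy]
    congr 1
    refine Finset.sum_congr rfl fun j _ => ?_
    rw [hxy, adjMat_apply, adjMat_apply]
    simp
  have hsymm : (adjMat G)ᵀ = adjMat G := by
    have := adjMat_isHermitian G
    rwa [Matrix.IsHermitian, conjTranspose_eq_transpose_of_trivial] at this
  apply le_antisymm
  · let f : (S → ℝ) →ₗ[ℝ] (V → ℝ) :=
      { toFun := fun y i => if h : i ∈ S then y ⟨i, h⟩ else 0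
        map_add' := by intro a b; ext i; by_cases h : i ∈ S <;> simp [h]
        map_smul' := by intro a b; ext i; by_cases h : i ∈ S <;> simp [h] }
    refine card_sign_le _ _ σ f fun y => (hsub _ _ ?_ ?_).symm
    · simp [f, S]
    · intro i
      have := i.2
      simp [f]
  · let g : (V → ℝ) →ₗ[ℝ] (V → ℝ) :=
      LinearMap.id - (LinearMap.proj z).smulRight ((w z)⁻¹ • w)
    let f : (V → ℝ) →ₗ[ℝ] (S → ℝ) := (LinearMap.funLeft ℝ ℝ Subtype.val) ∘ₗ g
    refine card_sign_le _ _ σ f fun x => ?_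
    rw [hsub (g x) (f x) (by simp [g, hz]) (fun i => by simp [f, LinearMap.funLeft])]
    have h1 : adjMat G *ᵥ g x = adjMat G *ᵥ x := by
      simp [g, mulVec_sub, mulVec_smul, hw]
    rw [h1, dotProduct_mulVec, ← mulVec_transpose, hsymm, h1, dotProduct_comm]

lemma memClass_delete {V : Type*} [Finite V] (G : SimpleGraph V) (z : V) {s : ℕ}
    (hw : ∀ [Fintype V] [DecidableEq V], ∃ w : V → ℝ, adjMat G *ᵥ w = 0 ∧ w z ≠ 0)
    (hG : memClass s G) : memClass (s - 1) (G.induce ({z}ᶜ : Set V)) := by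
  obtain ⟨h1, h2⟩ := hG
  letI := Fintype.ofFinite V
  letI := Classical.decEq V
  letI := Fintype.ofFinite ({z}ᶜ : Set V)
  letI := Classical.decEq ({z}ᶜ : Set V)
  obtain ⟨w, hw, hz⟩ := hw
  have p := sign_delete G z w hw hz 1
  have q := sign_delete G z w hw hz (-1)
  have a := card_split (eigs G)
  have b := card_split (eigs (G.induce ({z}ᶜ : Set V)))
  have c : Nat.card ({z}ᶜ : Set V) + 1 = Nat.card V := by
    rw [Nat.card_coe_set_eq, Set.ncard_compl, Set.ncard_singleton]
    have : 0 < Nat.card V := Nat.card_pos_iff.2 ⟨⟨z⟩, inferInstance⟩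
    omega
  unfold posCount at h1
  unfold nullCount at h2
  unfold memClass posCount nullCount
  simp only [one_mul] at p a b
  rw [p]
  refine ⟨h1, ?_⟩
  omega

/-! ### Forbidden induced subgraphs -/

lemma no_sub {V : Type*} [Finite V] (G : SimpleGraph V) (hG : posCount G = 2) {k : ℕ}
    (f : Fin k → V) (B : Matrix (Fin k) (Fin k) ℤ)
    (hB : ∀ i j, B i j = 1 ∧ G.Adj (f i) (f j) ∨ B i j = 0 ∧ ¬ G.Adj (f i) (f j))
    (P : Matrix (Fin 3) (Fin k) ℤ) (hP : P * B * Pᵀ = diagonal fun _ => 2) : False := by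
  classical
  letI := Fintype.ofFinite V
  letI := Classical.decEq V
  let E : Matrix (Fin k) V ℝ := fun i x => if f i = x then 1 else 0
  let Q : Matrix (Fin 3) (Fin k) ℝ := P.map (Int.castRingHom ℝ)
  have hE : E * adjMat G * Eᵀ = B.map (Int.castRingHom ℝ) := by
    ext i j
    have h0 : (E * adjMat G * Eᵀ) i j = adjMat G (f i) (f j) := by
      have e : ∀ a b, E a b = if f a = b then 1 else 0 := fun _ _ => rfl
      simp [e, Matrix.mul_apply]
    rw [h0, map_apply, adjMat_apply]
    rcases hB i j with ⟨h1, h2⟩ | ⟨h1, h2⟩ <;> simp [h1, h2]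
  have hQ : Q * (B.map (Int.castRingHom ℝ)) * Qᵀ = diagonal fun _ => 2 := by
    have := congrArg (fun M => M.map (Int.castRingHom ℝ)) hP
    simp only [Matrix.map_mul] at this
    rw [show Qᵀ = Pᵀ.map (Int.castRingHom ℝ) from rfl]
    rw [this]
    ext i j
    by_cases h : i = j <;> simp [diagonal, h]
  have := card_le_of_posDef (adjMat_isHermitian G) 1 (Matrix.mulVecLin (Q * E)ᵀ) (fun c hc => by
    rw [mulVecLin_apply, mulVec_transpose, ← dotProduct_mulVec, ← mulVec_transpose,
      mulVec_mulVec, mulVec_mulVec, transpose_mul, ← Matrix.mul_assoc, Matrix.mul_assoc Q,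
      Matrix.mul_assoc Q, hE, hQ]
    obtain ⟨a, ha⟩ := Function.ne_iff.1 hc
    simp only [one_mul, dotProduct, mulVec_diagonal]
    refine Finset.sum_pos' (fun i _ => ?_) ⟨a, Finset.mem_univ _, ?_⟩
    · nlinarith [sq_nonneg (c i)]
    · have : 0 < c a * c a := mul_self_pos.2 ha
      nlinarith)
  unfold posCount at hG
  simp only [one_mul] at this
  change _ ≤ Nat.card {i : V // 0 < eigs G i} at this
  rw [hG] at this
  simp at this

/-- The symmetric `0,1`-matrix of a graph on six vertices. -/
def mat6 (b01 b02 b03 b04 b05 b12 b13 b14 b15 b23 b24 b25 b34 b35 b45 : ℤ) :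
    Matrix (Fin 6) (Fin 6) ℤ :=
  ![![0, b01, b02, b03, b04, b05], ![b01, 0, b12, b13, b14, b15],
    ![b02, b12, 0, b23, b24, b25], ![b03, b13, b23, 0, b34, b35],
    ![b04, b14, b24, b34, 0, b45], ![b05, b15, b25, b35, b45, 0]]

/-- `b` is the indicator of adjacency of `x` and `y`. -/
def Ind {V : Type*} (G : SimpleGraph V) (x y : V) (b : ℤ) : Prop :=
  b = 1 ∧ G.Adj x y ∨ b = 0 ∧ ¬ G.Adj x y

lemma Ind.symm {V : Type*} {G : SimpleGraph V} {x y : V} {b : ℤ} (h : Ind G x y b) :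
    Ind G y x b := by
  unfold Ind at *
  rwa [G.adj_comm]

lemma no6 {V : Type*} [Finite V] {G : SimpleGraph V} (hG : posCount G = 2)
    (v0 v1 v2 v3 v4 v5 : V)
    {b01 b02 b03 b04 b05 b12 b13 b14 b15 b23 b24 b25 b34 b35 b45 : ℤ}
    (P : Matrix (Fin 3) (Fin 6) ℤ)
    (h01 : Ind G v0 v1 b01) (h02 : Ind G v0 v2 b02) (h03 : Ind G v0 v3 b03)
    (h04 : Ind G v0 v4 b04) (h05 : Ind G v0 v5 b05) (h12 : Ind G v1 v2 b12)
    (h13 : Ind G v1 v3 b13) (h14 : Ind G v1 v4 b14) (h15 : Ind G v1 v5 b15)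
    (h23 : Ind G v2 v3 b23) (h24 : Ind G v2 v4 b24) (h25 : Ind G v2 v5 b25)
    (h34 : Ind G v3 v4 b34) (h35 : Ind G v3 v5 b35) (h45 : Ind G v4 v5 b45)
    (hP : P * mat6 b01 b02 b03 b04 b05 b12 b13 b14 b15 b23 b24 b25 b34 b35 b45 * Pᵀ =
      diagonal fun _ => 2) : False := by
  have hl : ∀ x, Ind G x x 0 := fun x => Or.inr ⟨rfl, G.loopless.irrefl x⟩
  refine no_sub G hG ![v0, v1, v2, v3, v4, v5] _ (fun i j => ?_) P hP
  change Ind G _ _ _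
  fin_cases i <;> fin_cases j <;>
    first | exact hl _ | assumption | (apply Ind.symm; assumption)

lemma ind1 {V : Type*} {G : SimpleGraph V} {x y : V} (h : G.Adj x y) : Ind G x y 1 :=
  Or.inl ⟨rfl, h⟩

lemma ind0 {V : Type*} {G : SimpleGraph V} {x y : V} (h : ¬ G.Adj x y) : Ind G x y 0 :=
  Or.inr ⟨rfl, h⟩

lemma null_twin {V : Type*} (G : SimpleGraph V) {a b : V} (hab : a ≠ b)
    (h : ∀ w, G.Adj w a ↔ G.Adj w b) [Fintype V] [DecidableEq V] :
    ∃ w : V → ℝ, adjMat G *ᵥ w = 0 ∧ w a ≠ 0 := by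
  classical
  refine ⟨Pi.single a 1 - Pi.single b 1, ?_, by simp [hab]⟩
  ext i
  simp [mulVec_sub, adjMat_apply, h i]

lemma null_quad {V : Type*} (G : SimpleGraph V) {u v x y : V} (h : CongruentQuad G u v x y)
    [Fintype V] [DecidableEq V] :
    ∃ w : V → ℝ, adjMat G *ᵥ w = 0 ∧ w u ≠ 0 := by
  classical
  obtain ⟨huv, hux, huy, hvx, hvy, hxy, auv, avx, axy, ayu, nux, nvy, h1, h2⟩ := h
  refine ⟨Pi.single u 1 - Pi.single v 1 - Pi.single x 1 + Pi.single y 1, ?_,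
    by simp [huv, hux, huy]⟩
  ext i
  simp only [mulVec_sub, mulVec_add, mulVec_single_one, Pi.add_apply, Pi.sub_apply, col_apply,
    adjMat_apply, Pi.zero_apply]
  by_cases iu : i = u
  · subst iu
    simp [auv, nux, ayu.symm]
  by_cases iv : i = v
  · subst iv
    simp [auv.symm, avx, nvy]
  by_cases ix : i = x
  · subst ix
    simp [avx.symm, axy, mt SimpleGraph.Adj.symm nux]
  by_cases iy : i = y
  · subst iy
    simp [axy.symm, ayu, mt SimpleGraph.Adj.symm nvy]
  have e1 := Set.ext_iff.1 h1 i
  have e2 := Set.ext_iff.1 h2 i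
  simp only [Set.mem_sdiff, SimpleGraph.mem_neighborSet, Set.mem_insert_iff,
    Set.mem_singleton_iff, iu, iv, ix, iy, or_self, not_false_eq_true, and_true] at e1 e2
  rw [G.adj_comm i u, G.adj_comm i v, G.adj_comm i x, G.adj_comm i y]
  simp [e1, e2]

lemma deg_bound {V : Type*} [Finite V] {G : SimpleGraph V} {v : V} (hv : IsMinDegVertex G v)
    (x : V) (S T : Finset V) (hS : ∀ a ∈ S, G.Adj v a ∧ ¬ G.Adj x a)
    (hT : ∀ y, y ≠ v → ¬ G.Adj v y → G.Adj x y → y ∈ T) : S.card ≤ 1 + T.card := by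
  classical
  letI := Fintype.ofFinite V
  have h := hv x
  simp only [deg, Nat.card_coe_set_eq, Set.ncard_eq_toFinset_card'] at h
  set NV := (G.neighborSet v).toFinset with hNV
  set NX := (G.neighborSet x).toFinset with hNX
  have hSN : S ⊆ NV := fun a ha => by simpa [hNV] using (hS a ha).1
  have hsub : NX ⊆ (NV \ S) ∪ ({v} ∪ T) := by
    intro a ha
    have ha' : G.Adj x a := by simpa [hNX] using ha
    by_cases h1 : a = v
    · simp [h1]
    by_cases h2 : G.Adj v a
    · have h3 : a ∉ S := fun h3 => (hS a h3).2 ha'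
      simp [hNV, h2, h3]
    · simp [hT a h1 h2 ha']
  have c1 := Finset.card_le_card hsub
  have c2 := Finset.card_union_le (NV \ S) ({v} ∪ T)
  have c3 := Finset.card_union_le {v} T
  have c4 := Finset.card_sdiff_add_card_eq_card hSN
  simp only [Finset.card_singleton] at c3
  omega

/-- Non-adjacent vertices of `X` with the same trace on `Y` have the same neighbourhood:
one direction of the comparison. -/
lemma twin_aux {V : Type*} [Finite V] {G : SimpleGraph V} (hG : posCount G = 2) {v : V}
    (hv : IsMinDegVertex G v)
    (hYcl : ∀ a b, a ≠ v → ¬ G.Adj v a → b ≠ v → ¬ G.Adj v b → a ≠ b → G.Adj a b)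
    {x₁ x₂ x₃ : V} (h1 : G.Adj v x₁) (h2 : G.Adj v x₂) (h3 : G.Adj v x₃)
    (h12 : ¬ G.Adj x₁ x₂) (hne : x₁ ≠ x₂)
    (hY : ∀ y, y ≠ v → ¬ G.Adj v y → (G.Adj x₁ y ↔ G.Adj x₂ y))
    (h13 : G.Adj x₁ x₃) : G.Adj x₂ x₃ := by
  classical
  letI := Fintype.ofFinite V
  by_contra h23
  have hcard := deg_bound hv x₂ {x₁, x₂, x₃}
    (Finset.univ.filter fun y => y ≠ v ∧ ¬ G.Adj v y ∧ G.Adj x₂ y)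
    (by
      intro a ha
      simp only [Finset.mem_insert, Finset.mem_singleton] at ha
      rcases ha with rfl | rfl | rfl
      · exact ⟨h1, mt SimpleGraph.Adj.symm h12⟩
      · exact ⟨h2, G.loopless.irrefl _⟩
      · exact ⟨h3, h23⟩)
    (by intro y a b c; simp [a, b, c])
  have hne23 : x₂ ≠ x₃ := by rintro rfl; exact h12 h13
  rw [Finset.card_eq_three.2 ⟨x₁, x₂, x₃, hne, h13.ne, hne23, rfl⟩] at hcard
  obtain ⟨y₁, hy₁, y₂, hy₂, hyy⟩ := Finset.one_lt_card.1 (Nat.lt_of_succ_le (Nat.le_of_add_le_add_left hcard))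
  simp only [Finset.mem_filter, Finset.mem_univ, true_and] at hy₁ hy₂
  obtain ⟨a1, b1, c1⟩ := hy₁
  obtain ⟨a2, b2, c2⟩ := hy₂
  have d1 := (hY y₁ a1 b1).2 c1
  have d2 := (hY y₂ a2 b2).2 c2
  have e := hYcl y₁ y₂ a1 b1 a2 b2 hyy
  by_cases f1 : G.Adj x₃ y₁ <;> by_cases f2 : G.Adj x₃ y₂
  · exact no6 hG v x₁ x₂ x₃ y₁ y₂
      ![![1, 1, 0, 0, 0, 0], ![1, -1, 2, -1, 0, 0], ![-2, 0, 0, 0, 1, 1]]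
      (ind1 h1) (ind1 h2) (ind1 h3) (ind0 b1) (ind0 b2) (ind0 h12) (ind1 h13) (ind1 d1) (ind1 d2)
      (ind0 h23) (ind1 c1) (ind1 c2) (ind1 f1) (ind1 f2) (ind1 e) (by decide)
  · exact no6 hG v x₁ x₂ x₃ y₁ y₂
      ![![1, 1, 0, 0, 0, 0], ![1, -1, 2, -1, 0, 0], ![-2, 1, -1, 0, 1, 1]]
      (ind1 h1) (ind1 h2) (ind1 h3) (ind0 b1) (ind0 b2) (ind0 h12) (ind1 h13) (ind1 d1) (ind1 d2)
      (ind0 h23) (ind1 c1) (ind1 c2) (ind1 f1) (ind0 f2) (ind1 e) (by decide)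
  · exact no6 hG v x₁ x₂ x₃ y₁ y₂
      ![![1, 1, 0, 0, 0, 0], ![1, -1, 2, -1, 0, 0], ![-2, 1, -1, 0, 1, 1]]
      (ind1 h1) (ind1 h2) (ind1 h3) (ind0 b1) (ind0 b2) (ind0 h12) (ind1 h13) (ind1 d1) (ind1 d2)
      (ind0 h23) (ind1 c1) (ind1 c2) (ind0 f1) (ind1 f2) (ind1 e) (by decide)
  · exact no6 hG v x₁ x₂ x₃ y₁ y₂
      ![![1, 1, 0, 0, 0, 0], ![1, -1, 2, -1, 0, 0], ![-2, 2, -2, 0, 1, 1]]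
      (ind1 h1) (ind1 h2) (ind1 h3) (ind0 b1) (ind0 b2) (ind0 h12) (ind1 h13) (ind1 d1) (ind1 d2)
      (ind0 h23) (ind1 c1) (ind1 c2) (ind0 f1) (ind0 f2) (ind1 e) (by decide)

/-- Non-adjacent vertices of `X` with different traces on `Y` give a congruent quadrangle. -/
lemma quad_aux {V : Type*} [Finite V] {G : SimpleGraph V} (hG : posCount G = 2) {v : V}
    (hv : IsMinDegVertex G v)
    (hYcl : ∀ a b, a ≠ v → ¬ G.Adj v a → b ≠ v → ¬ G.Adj v b → a ≠ b → G.Adj a b)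
    {x₁ x₂ y₂ : V} (h1 : G.Adj v x₁) (h2 : G.Adj v x₂)
    (h12 : ¬ G.Adj x₁ x₂) (hne : x₁ ≠ x₂)
    (a2 : y₂ ≠ v) (b2 : ¬ G.Adj v y₂) (d2 : ¬ G.Adj x₁ y₂) (c2 : G.Adj x₂ y₂) :
    ∃ y, CongruentQuad G v x₁ y x₂ := by
  classical
  have hl := G.loopless.irrefl
  -- `x₁` has a neighbour in `Y`
  obtain ⟨y, ay, bY, dy⟩ : ∃ y, y ≠ v ∧ ¬ G.Adj v y ∧ G.Adj x₁ y := by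
    by_contra! hcon
    have := deg_bound hv x₁ {x₁, x₂} ∅ (by simp [h1, h2, h12])
      (fun y a b c => absurd c (hcon y a b))
    rw [Finset.card_pair hne] at this
    simp at this
  have hyy : ∀ z, z ≠ v → ¬ G.Adj v z → G.Adj x₁ z → z ≠ y₂ := by
    rintro z - - h rfl
    exact d2 h
  -- neighbours of `x₁` in `Y` are neighbours of `x₂`
  have hsub : ∀ z, z ≠ v → ¬ G.Adj v z → G.Adj x₁ z → G.Adj x₂ z := by
    intro z az bz dz
    by_contra cz
    exact no6 hG v x₁ x₂ v z y₂
      ![![1, 1, 0, 0, 0, 0], ![-1, 1, -1, 0, 1, 0], ![-1, -1, 1, 0, 1, 1]]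
      (ind1 h1) (ind1 h2) (ind0 (hl v)) (ind0 bz) (ind0 b2) (ind0 h12) (ind1 h1.symm) (ind1 dz)
      (ind0 d2) (ind1 h2.symm) (ind0 cz) (ind1 c2) (ind0 bz) (ind0 b2)
      (ind1 (hYcl z y₂ az bz a2 b2 (hyy z az bz dz))) (by decide)
  have cy := hsub y ay bY dy
  have ey := hYcl y y₂ ay bY a2 b2 (hyy y ay bY dy)
  -- `x₁` has a unique neighbour in `Y`
  have huniq : ∀ z, z ≠ v → ¬ G.Adj v z → G.Adj x₁ z → z = y := by
    intro z az bz dz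
    by_contra hzy
    have cz := hsub z az bz dz
    have ez := hYcl z y₂ az bz a2 b2 (hyy z az bz dz)
    have f := hYcl y z ay bY az bz (Ne.symm hzy)
    exact no6 hG v x₁ x₂ y₂ y z
      ![![1, 1, 0, 0, 0, 0], ![0, -1, 1, 1, 0, 0], ![-2, 2, -2, 0, 1, 1]]
      (ind1 h1) (ind1 h2) (ind0 b2) (ind0 bY) (ind0 bz) (ind0 h12) (ind0 d2) (ind1 dy) (ind1 dz)
      (ind1 c2) (ind1 cy) (ind1 cz) (ind1 ey.symm) (ind1 ez.symm) (ind1 f) (by decide)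
  -- `x₂` is adjacent to all of `Y`
  have hall : ∀ z, z ≠ v → ¬ G.Adj v z → G.Adj x₂ z := by
    intro z az bz
    by_contra cz
    have dz : ¬ G.Adj x₁ z := fun h => cz (hsub z az bz h)
    have e1 := hYcl z y az bz ay bY (by rintro rfl; exact dz dy)
    have e2 := hYcl z y₂ az bz a2 b2 (by rintro rfl; exact cz c2)
    exact no6 hG v x₁ x₂ z y y₂
      ![![1, 1, 0, 0, 0, 0], ![0, -1, 1, 0, 0, 1], ![-1, 2, -2, 2, 1, -1]]
      (ind1 h1) (ind1 h2) (ind0 bz) (ind0 bY) (ind0 b2) (ind0 h12) (ind0 dz) (ind1 dy) (ind0 d2)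
      (ind0 cz) (ind1 cy) (ind1 c2) (ind1 e1) (ind1 e2) (ind1 ey) (by decide)
  -- `x₁` is adjacent to all of `X` but `x₂`
  have hX : ∀ z, G.Adj v z → z ≠ x₁ → z ≠ x₂ → G.Adj x₁ z := by
    intro z hz z1 z2
    by_contra hc
    have := deg_bound hv x₁ {x₁, x₂, z} {y} (by simp [h1, h2, h12, hz, hc])
      (fun w a b c => by simpa using huniq w a b c)
    rw [Finset.card_eq_three.2 ⟨x₁, x₂, z, hne, z1.symm, z2.symm, rfl⟩] at this
    simp at this
  -- `x₂` and `y` have the same further neighbours in `X`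
  have hiff : ∀ z, G.Adj v z → z ≠ x₁ → z ≠ x₂ → (G.Adj y z ↔ G.Adj x₂ z) := by
    intro z h3 z1 z2
    have h13 := hX z h3 z1 z2
    by_contra hc
    by_cases f1 : G.Adj z y <;> by_cases f2 : G.Adj z y₂
    · have h23 : ¬ G.Adj x₂ z := fun h => hc (iff_of_true f1.symm h)
      exact no6 hG v x₁ x₂ z y y₂
        ![![1, 1, 0, 0, 0, 0], ![1, -1, 2, -1, 0, 0], ![-2, 0, -1, 1, 1, 1]]
        (ind1 h1) (ind1 h2) (ind1 h3) (ind0 bY) (ind0 b2) (ind0 h12) (ind1 h13) (ind1 dy)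
        (ind0 d2) (ind0 h23) (ind1 cy) (ind1 c2) (ind1 f1) (ind1 f2) (ind1 ey) (by decide)
    · have h23 : ¬ G.Adj x₂ z := fun h => hc (iff_of_true f1.symm h)
      exact no6 hG v x₁ x₂ z y y₂
        ![![1, 1, 0, 0, 0, 0], ![1, -1, 2, -1, 0, 0], ![-3, 1, -2, 1, 2, 1]]
        (ind1 h1) (ind1 h2) (ind1 h3) (ind0 bY) (ind0 b2) (ind0 h12) (ind1 h13) (ind1 dy)
        (ind0 d2) (ind0 h23) (ind1 cy) (ind1 c2) (ind1 f1) (ind0 f2) (ind1 ey) (by decide)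
    · have h23 : G.Adj x₂ z := by
        by_contra h
        exact hc (iff_of_false (mt SimpleGraph.Adj.symm f1) h)
      exact no6 hG v x₁ x₂ z y y₂
        ![![1, 1, 0, 0, 0, 0], ![-1, 1, 0, -1, 2, 0], ![0, -2, 1, 1, -1, 1]]
        (ind1 h1) (ind1 h2) (ind1 h3) (ind0 bY) (ind0 b2) (ind0 h12) (ind1 h13) (ind1 dy)
        (ind0 d2) (ind1 h23) (ind1 cy) (ind1 c2) (ind0 f1) (ind1 f2) (ind1 ey) (by decide)
    · have h23 : G.Adj x₂ z := by
        by_contra h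
        exact hc (iff_of_false (mt SimpleGraph.Adj.symm f1) h)
      exact no6 hG v x₁ x₂ z y y₂
        ![![1, 1, 0, 0, 0, 0], ![-1, 1, 0, -1, 2, 0], ![1, -3, 2, 1, -2, 1]]
        (ind1 h1) (ind1 h2) (ind1 h3) (ind0 bY) (ind0 b2) (ind0 h12) (ind1 h13) (ind1 dy)
        (ind0 d2) (ind1 h23) (ind1 cy) (ind1 c2) (ind0 f1) (ind0 f2) (ind1 ey) (by decide)
  refine ⟨y, h1.ne, Ne.symm ay, h2.ne, dy.ne, hne, cy.ne.symm, h1, dy, cy.symm, h2.symm, bY, h12,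
    ?_, ?_⟩
  · ext z
    simp only [Set.mem_sdiff, SimpleGraph.mem_neighborSet, Set.mem_insert_iff,
      Set.mem_singleton_iff, not_or]
    constructor
    · rintro ⟨hz, z2, z1⟩
      exact ⟨hX z hz z1 z2, hz.ne.symm, by rintro rfl; exact bY hz⟩
    · rintro ⟨hz, zv, zy⟩
      refine ⟨?_, by rintro rfl; exact h12 hz, hz.ne.symm⟩
      by_contra hvz
      exact zy (huniq z zv hvz hz)
  · ext z
    simp only [Set.mem_sdiff, SimpleGraph.mem_neighborSet, Set.mem_insert_iff,
      Set.mem_singleton_iff, not_or]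
    constructor
    · rintro ⟨hz, z1, z2⟩
      have zv : z ≠ v := by rintro rfl; exact bY hz.symm
      refine ⟨?_, hz.ne.symm, zv⟩
      by_cases hvz : G.Adj v z
      · exact (hiff z hvz z1 z2).1 hz
      · exact hall z zv hvz
    · rintro ⟨hz, zy, zv⟩
      have z1 : z ≠ x₁ := by rintro rfl; exact h12 hz.symm
      refine ⟨?_, z1, hz.ne.symm⟩
      by_cases hvz : G.Adj v z
      · exact (hiff z hvz z1 hz.ne.symm).2 hz
      · exact hYcl y z ay bY zv hvz (Ne.symm zy)

theorem Xincomplete_dichotomy {n s : ℕ} (hs : 2 ≤ s) (hsn : s ≤ n - 3)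
    (G : SimpleGraph (Fin n)) (hconn : G.Connected) (hG : memClass s G)
    (v : Fin n) (hv : IsMinDegVertex G v)
    (X Y : Set (Fin n)) (hX : X = G.neighborSet v) (hY : Y = Yset G v)
    (hYcl : Y.Pairwise G.Adj) (hYcard : 2 ≤ Y.ncard) (hXinc : ¬ X.Pairwise G.Adj) :
    ((∃ x₁ ∈ X, ∃ x₂ ∈ X, x₁ ≠ x₂ ∧ ¬ G.Adj x₁ x₂ ∧
        G.neighborSet x₁ ∩ Y = G.neighborSet x₂ ∩ Y) → memG1 s G) ∧
    (¬ (∃ x₁ ∈ X, ∃ x₂ ∈ X, x₁ ≠ x₂ ∧ ¬ G.Adj x₁ x₂ ∧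
        G.neighborSet x₁ ∩ Y = G.neighborSet x₂ ∩ Y) → memG3 s G) := by
  have hmY : ∀ a, a ∈ Y ↔ a ≠ v ∧ ¬ G.Adj v a := by
    intro a
    rw [hY]
    simp only [Yset, Set.mem_compl_iff, Set.mem_union, SimpleGraph.mem_neighborSet,
      Set.mem_singleton_iff, not_or]
    tauto
  have hYcl' : ∀ a b, a ≠ v → ¬ G.Adj v a → b ≠ v → ¬ G.Adj v b → a ≠ b → G.Adj a b :=
    fun a b h1 h2 h3 h4 hab => hYcl ((hmY a).2 ⟨h1, h2⟩) ((hmY b).2 ⟨h3, h4⟩) hab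
  have hp := hG.1
  subst hX
  constructor
  · rintro ⟨x₁, h1, x₂, h2, hne, h12, hN⟩
    rw [SimpleGraph.mem_neighborSet] at h1 h2
    have hN' : ∀ y, y ≠ v → ¬ G.Adj v y → (G.Adj x₁ y ↔ G.Adj x₂ y) := by
      intro y a b
      have := Set.ext_iff.1 hN y
      simpa [(hmY y).2 ⟨a, b⟩] using this
    have htw : ∀ w, G.Adj x₁ w ↔ G.Adj x₂ w := by
      intro w
      by_cases hwv : w = v
      · subst hwv
        exact iff_of_true h1.symm h2.symm
      by_cases hw : G.Adj v w
      · exact ⟨twin_aux hp hv hYcl' h1 h2 hw h12 hne hN',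
          twin_aux hp hv hYcl' h2 h1 hw (mt SimpleGraph.Adj.symm h12) hne.symm (fun y a b => (hN' y a b).symm)⟩
      · exact hN' w hwv hw
    refine ⟨hconn, x₁, ⟨x₂, hne.symm, mt SimpleGraph.Adj.symm h12, ?_⟩, memClass_delete G x₁ ?_ hG⟩
    · ext w
      exact (htw w).symm
    · intro _ _
      exact null_twin G hne fun w => by rw [G.adj_comm w, G.adj_comm w, htw]
  · intro hno
    have key : ∃ x₁ x₂ y, CongruentQuad G v x₁ y x₂ := by
      simp only [Set.Pairwise, not_forall] at hXinc
      obtain ⟨x₁, h1, x₂, h2, hne, h12⟩ := hXinc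
      have hd : ¬ ∀ y, y ∈ Y → (G.Adj x₁ y ↔ G.Adj x₂ y) := by
        intro h
        refine hno ⟨x₁, h1, x₂, h2, hne, h12, ?_⟩
        ext y
        simp only [Set.mem_inter_iff, SimpleGraph.mem_neighborSet]
        exact and_congr_left (h y)
      push Not at hd
      obtain ⟨y, hy, hd⟩ := hd
      obtain ⟨a, b⟩ := (hmY y).1 hy
      rcases hd with ⟨c, d⟩ | ⟨c, d⟩
      · obtain ⟨z, hz⟩ := quad_aux hp hv hYcl' h2 h1 (mt SimpleGraph.Adj.symm h12) (Ne.symm hne) a b d c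
        exact ⟨_, _, _, hz⟩
      · obtain ⟨z, hz⟩ := quad_aux hp hv hYcl' h1 h2 h12 hne a b c d
        exact ⟨_, _, _, hz⟩
    obtain ⟨x₁, x₂, y, hq⟩ := key
    refine ⟨hconn, v, ⟨v, x₁, y, x₂, hq, Or.inl rfl⟩, memClass_delete G v ?_ hG⟩
    intro _ _
    exact null_quad G hq

end TwoPosEig
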